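/- Let ℓ, h be natural numbers with h ≤ ℓ and let σ be a finset of Fin ℓ with |σ| = r and r ≤ h. Then the number of vectors v : Fin ℓ → ZMod 2 with |supp(v)| ≤ h and σ ⊆ supp(v) equals ∑_{i=0}^{h−r} C(ℓ−r, i). (This is the Hamming weight of the row of the generating matrix of the skeleton code corresponding to the monomial Π_{k∈σ} x_k.) -/

import Mathlib

open Finset

/-- The support of a vector over `ZMod 2`, as a finset. -/
def suppF {ℓ : ℕ} (v : Fin ℓ → ZMod 2) : Finset (Fin ℓ) :=
  univ.filter fun i => v i ≠ 0

theorem mem_suppF {ℓ : ℕ} {v : Fin ℓ → ZMod 2} {i : Fin ℓ} : i ∈ suppF v ↔ v i ≠ 0 := by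
  simp [suppF]

theorem suppF_injective {ℓ : ℕ} : Function.Injective (suppF (ℓ := ℓ)) := by
  intro v w hvw
  funext i
  have hi : v i ≠ 0 ↔ w i ≠ 0 := by rw [← mem_suppF, ← mem_suppF, hvw]
  have key : ∀ a b : ZMod 2, (a ≠ 0 ↔ b ≠ 0) → a = b := by decide
  exact key _ _ hi

theorem suppF_indicator {ℓ : ℕ} (s : Finset (Fin ℓ)) :
    suppF (fun i => if i ∈ s then 1 else 0) = s := by
  ext i
  simp [mem_suppF]

/-- The number of subsets of `s` with at most `n` elements. -/
theorem card_filter_powerset_card_le {α : Type*} [DecidableEq α] (s : Finset α) (n : ℕ) :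
    (s.powerset.filter fun t => t.card ≤ n).card = ∑ i ∈ range (n + 1), s.card.choose i := by
  rw [card_eq_sum_card_fiberwise (f := card) (t := range (n + 1))]
  · refine sum_congr rfl fun i hi => ?_
    rw [← card_powersetCard]
    congr 1
    ext t
    simp only [mem_filter, mem_powerset, mem_powersetCard, mem_range] at hi ⊢
    grind
  · intro t ht
    simp only [coe_filter, Set.mem_ofPred_eq, coe_range, Set.mem_Iio] at ht ⊢
    omega

theorem row_weight (ℓ h r : ℕ) (hh : h ≤ ℓ) (σ : Finset (Fin ℓ))
    (hσ : σ.card = r) (hr : r ≤ h) :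
    (univ.filter fun v : Fin ℓ → ZMod 2 =>
        (suppF v).card ≤ h ∧ σ ⊆ suppF v).card =
      ∑ i ∈ Finset.range (h - r + 1), (ℓ - r).choose i := by
  have hcompl : σᶜ.card = ℓ - r := by rw [card_compl, Fintype.card_fin, hσ]
  rw [← hcompl, ← card_filter_powerset_card_le]
  refine card_bij (fun v _ => suppF v \ σ) ?_ ?_ ?_
  · intro v hv
    simp only [mem_filter, mem_univ, true_and, mem_powerset] at hv ⊢
    refine ⟨fun i hi => by simp_all, ?_⟩
    rw [card_sdiff_of_subset hv.2]
    omega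
  · intro v hv w hw hvw
    simp only [mem_filter, mem_univ, true_and] at hv hw
    apply suppF_injective
    rw [← sdiff_union_of_subset hv.2, hvw, sdiff_union_of_subset hw.2]
  · intro t ht
    simp only [mem_filter, mem_powerset] at ht
    have hdisj : Disjoint t σ := by rw [← subset_compl_iff_disjoint_right]; exact ht.1
    refine ⟨fun i => if i ∈ t ∪ σ then 1 else 0, ?_, ?_⟩
    · simp only [mem_filter, mem_univ, true_and, suppF_indicator]
      refine ⟨?_, subset_union_right⟩
      rw [card_union_of_disjoint hdisj]
      omega
    · rw [suppF_indicator, union_sdiff_cancel_right hdisj]
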